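/- arXiv:1507.04177 — 10 statements merged into one kernel-verified Lean document; each statement's English description precedes it below -/
import Mathlib

section
/- Let P := I − τL with 0 < τ and τ·∑_{j≠i} a_{ij} ≤ 1 for every i. Then the Cesàro averages (1/k)·∑_{i=1}^{k} P^i converge entrywise, as k → ∞, to the eigenprojection J̃ of L; in particular, for every initial vector y(0) ∈ ℝⁿ, lim_{k→∞} (1/k)·∑_{i=1}^{k} P^i y(0) = J̃·y(0). -/
open Matrix in
/-- A nonnegative matrix with unit row sums is nonexpansive for the sup norm. -/
theorem norm_mulVec_le_of_rowSum_eq_one {m : Type*} [Fintype m] {P : Matrix m m ℝ}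
    (h0 : ∀ i j, 0 ≤ P i j) (h1 : ∀ i, ∑ j, P i j = 1) (v : m → ℝ) : ‖P *ᵥ v‖ ≤ ‖v‖ := by
  refine (pi_norm_le_iff_of_nonneg (norm_nonneg v)).2 fun i => ?_
  calc ‖(P *ᵥ v) i‖ ≤ ∑ j, ‖P i j * v j‖ := norm_sum_le _ _
    _ ≤ ∑ j, P i j * ‖v‖ := by
        refine Finset.sum_le_sum fun j _ => ?_
        rw [norm_mul, Real.norm_of_nonneg (h0 i j)]
        exact mul_le_mul_of_nonneg_left (norm_le_pi_norm v j) (h0 i j)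
    _ = ‖v‖ := by rw [← Finset.sum_mul, h1, one_mul]

open Matrix in
theorem norm_pow_mulVec_le {m : Type*} [Fintype m] [DecidableEq m] {P : Matrix m m ℝ}
    (hP : ∀ v, ‖P *ᵥ v‖ ≤ ‖v‖) (k : ℕ) (v : m → ℝ) : ‖(P ^ k) *ᵥ v‖ ≤ ‖v‖ := by
  induction k with
  | zero => simp
  | succ k ih =>
    rw [pow_succ', ← mulVec_mulVec]
    exact (hP _).trans ih

open Matrix in
/-- If `1 - τ • L` is nonexpansive with `τ > 0`, then `ker (L ^ 2) ⊆ ker L`. -/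
theorem mulVec_eq_zero_of_mulVec_mulVec_eq_zero {m : Type*} [Fintype m] [DecidableEq m]
    {L : Matrix m m ℝ} {τ : ℝ} (hτ : 0 < τ) (hP : ∀ v, ‖(1 - τ • L) *ᵥ v‖ ≤ ‖v‖)
    {x : m → ℝ} (hx : L *ᵥ (L *ᵥ x) = 0) : L *ᵥ x = 0 := by
  have key : ∀ k : ℕ, ((1 - τ • L) ^ k) *ᵥ x = x - (k * τ) • (L *ᵥ x) := by
    intro k
    induction k with
    | zero => simp
    | succ k ih =>
      rw [pow_succ', ← mulVec_mulVec, ih, sub_mulVec, one_mulVec, smul_mulVec, mulVec_sub,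
        mulVec_smul, hx]
      push_cast
      module
  by_contra hne
  have hpos : 0 < τ * ‖L *ᵥ x‖ := mul_pos hτ (norm_pos_iff.2 hne)
  obtain ⟨k, hk⟩ := exists_nat_gt (2 * ‖x‖ / (τ * ‖L *ᵥ x‖))
  rw [div_lt_iff₀ hpos] at hk
  have h1 : (k * τ) • (L *ᵥ x) = x - ((1 - τ • L) ^ k) *ᵥ x := by rw [key]; abel
  have h2 : ‖((k : ℝ) * τ) • (L *ᵥ x)‖ ≤ ‖x‖ + ‖x‖ := by
    rw [h1]
    exact (norm_sub_le _ _).trans (add_le_add_right (norm_pow_mulVec_le hP k x) _)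
  rw [norm_smul, Real.norm_of_nonneg (by positivity)] at h2
  linarith

open Matrix in
theorem mulVec_eq_zero_of_pow_mulVec_eq_zero {m : Type*} [Fintype m] [DecidableEq m]
    {L : Matrix m m ℝ} {τ : ℝ} (hτ : 0 < τ) (hP : ∀ v, ‖(1 - τ • L) *ᵥ v‖ ≤ ‖v‖)
    (k : ℕ) {x : m → ℝ} (hx : (L ^ k) *ᵥ x = 0) : L *ᵥ x = 0 := by
  induction k generalizing x with
  | zero =>
    rw [pow_zero, one_mulVec] at hx
    rw [hx, mulVec_zero]
  | succ k ih =>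
    rw [pow_succ, ← mulVec_mulVec] at hx
    exact mulVec_eq_zero_of_mulVec_mulVec_eq_zero hτ hP (ih hx)

open Matrix in
theorem sum_Icc_pow_mulVec_mulVec {m : Type*} [Fintype m] [DecidableEq m]
    (L : Matrix m m ℝ) (τ : ℝ) (w : m → ℝ) (k : ℕ) :
    τ • ((∑ i ∈ Finset.Icc 1 k, (1 - τ • L) ^ i) *ᵥ (L *ᵥ w)) =
      (1 - τ • L) *ᵥ w - ((1 - τ • L) ^ (k + 1)) *ᵥ w := by
  induction k with
  | zero => simp
  | succ k ih =>
    have h : τ • (L *ᵥ w) = w - (1 - τ • L) *ᵥ w := by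
      rw [sub_mulVec, one_mulVec, smul_mulVec]; abel
    rw [Finset.sum_Icc_succ_top (by omega), add_mulVec, smul_add, ih, ← mulVec_smul, h,
      mulVec_sub, mulVec_mulVec, ← pow_succ]
    abel

open Matrix Filter Topology in
theorem tendsto_cesaro_pow_mulVec_mulVec {m : Type*} [Fintype m] [DecidableEq m]
    {L : Matrix m m ℝ} {τ : ℝ} (hτ : 0 < τ) (hP : ∀ v, ‖(1 - τ • L) *ᵥ v‖ ≤ ‖v‖) (w : m → ℝ) :
    Tendsto (fun k : ℕ => ((k : ℝ)⁻¹ • ∑ i ∈ Finset.Icc 1 k, (1 - τ • L) ^ i) *ᵥ (L *ᵥ w))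
      atTop (𝓝 0) := by
  have hlim : Tendsto (fun k : ℕ => (k : ℝ)⁻¹ * (τ⁻¹ * (‖w‖ + ‖w‖))) atTop (𝓝 0) := by
    simpa using (tendsto_inv_atTop_nhds_zero_nat (𝕜 := ℝ)).mul_const (τ⁻¹ * (‖w‖ + ‖w‖))
  refine squeeze_zero_norm (fun k => ?_) hlim
  have h : (∑ i ∈ Finset.Icc 1 k, (1 - τ • L) ^ i) *ᵥ (L *ᵥ w) =
      τ⁻¹ • ((1 - τ • L) *ᵥ w - ((1 - τ • L) ^ (k + 1)) *ᵥ w) := by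
    rw [← sum_Icc_pow_mulVec_mulVec, inv_smul_smul₀ hτ.ne']
  rw [smul_mulVec, h, norm_smul, norm_smul, Real.norm_of_nonneg (by positivity),
    Real.norm_of_nonneg (by positivity)]
  gcongr
  exact (norm_sub_le _ _).trans (add_le_add (hP w) (norm_pow_mulVec_le hP _ w))

open Matrix Filter Topology in
theorem tendsto_cesaro_pow_mulVec_of_mulVec_eq_self {m : Type*} [Fintype m] [DecidableEq m]
    {P : Matrix m m ℝ} {v : m → ℝ} (hv : P *ᵥ v = v) :
    Tendsto (fun k : ℕ => ((k : ℝ)⁻¹ • ∑ i ∈ Finset.Icc 1 k, P ^ i) *ᵥ v) atTop (𝓝 v) := by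
  have hpow : ∀ i : ℕ, (P ^ i) *ᵥ v = v := by
    intro i
    induction i with
    | zero => simp
    | succ i ih => rw [pow_succ, ← mulVec_mulVec, hv, ih]
  refine tendsto_const_nhds.congr' ?_
  filter_upwards [eventually_ne_atTop 0] with k hk
  have hk' : (k : ℝ) ≠ 0 := Nat.cast_ne_zero.2 hk
  rw [smul_mulVec, sum_mulVec, Finset.sum_congr rfl fun i _ => hpow i, Finset.sum_const,
    Nat.card_Icc, Nat.add_sub_cancel, ← Nat.cast_smul_eq_nsmul ℝ, inv_smul_smul₀ hk']

open Matrix in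
theorem range_pow_mulVecLin_le {m : Type*} [Fintype m] [DecidableEq m] {L : Matrix m m ℝ} {k : ℕ}
    (hk : (L ^ (k + 1)).rank = (L ^ k).rank) :
    LinearMap.range (L ^ k).mulVecLin ≤ LinearMap.range L.mulVecLin := by
  have hle : ∀ l : ℕ, LinearMap.range (L ^ (l + 1)).mulVecLin ≤ LinearMap.range L.mulVecLin := by
    rintro l _ ⟨x, rfl⟩
    exact ⟨(L ^ l) *ᵥ x, by simp [pow_succ']⟩
  have hsub : LinearMap.range (L ^ (k + 1)).mulVecLin ≤ LinearMap.range (L ^ k).mulVecLin := by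
    rintro _ ⟨x, rfl⟩
    exact ⟨L *ᵥ x, by simp [pow_succ]⟩
  rw [← Submodule.eq_of_le_of_finrank_eq hsub hk]
  exact hle k


/-- Cesàro averages (1/k)·∑_{i=1}^k Pⁱ of P = I − τL converge to the eigenprojection J̃. -/
theorem stmt1 {n : ℕ} (hn : 0 < n) (A L : Matrix (Fin n) (Fin n) ℝ)
    (hA : ∀ i j, 0 ≤ A i j)
    (hL : L = Matrix.diagonal (fun i => ∑ j, A i j) - A)
    (ν : ℕ) (hν : IsLeast {k : ℕ | (L ^ (k + 1)).rank = (L ^ k).rank} ν)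
    (J : Matrix (Fin n) (Fin n) ℝ)
    (hJ2 : J * J = J)
    (hJr : LinearMap.range J.mulVecLin = LinearMap.ker (L ^ ν).mulVecLin)
    (hJk : LinearMap.ker J.mulVecLin = LinearMap.range (L ^ ν).mulVecLin)
    (τ : ℝ) (hτ : 0 < τ)
    (hτ1 : ∀ i, τ * ∑ j ∈ Finset.univ.erase i, A i j ≤ 1)
    (P : Matrix (Fin n) (Fin n) ℝ) (hP : P = 1 - τ • L) :
    Filter.Tendsto (fun k : ℕ => (k : ℝ)⁻¹ • ∑ i ∈ Finset.Icc 1 k, P ^ i)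
      Filter.atTop (nhds J) ∧
      ∀ y₀ : Fin n → ℝ,
        Filter.Tendsto (fun k : ℕ => ((k : ℝ)⁻¹ • ∑ i ∈ Finset.Icc 1 k, P ^ i).mulVec y₀)
          Filter.atTop (nhds (J.mulVec y₀)) := by
  have h0 : ∀ i j, 0 ≤ P i j := by
    intro i j
    rcases eq_or_ne i j with rfl | hij
    · have h := hτ1 i
      have hs := Finset.add_sum_erase Finset.univ (A i) (Finset.mem_univ i)
      have hPii : P i i = 1 - τ * ∑ j ∈ Finset.univ.erase i, A i j := by
        rw [hP, hL, Matrix.sub_apply, Matrix.smul_apply, Matrix.sub_apply, Matrix.one_apply_eq,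
          Matrix.diagonal_apply_eq, ← hs, add_sub_cancel_left, smul_eq_mul]
      linarith
    · simpa [hP, hL, hij] using mul_nonneg hτ.le (hA i j)
  have h1 : ∀ i, ∑ j, P i j = 1 := by
    intro i
    simp [hP, hL, Finset.sum_sub_distrib, ← Finset.mul_sum, Matrix.one_apply,
      Matrix.diagonal_apply]
  have hcontr : ∀ v, ‖(1 - τ • L).mulVec v‖ ≤ ‖v‖ := by
    rw [← hP]
    exact norm_mulVec_le_of_rowSum_eq_one h0 h1
  have hvec : ∀ y : Fin n → ℝ,
      Filter.Tendsto (fun k : ℕ => ((k : ℝ)⁻¹ • ∑ i ∈ Finset.Icc 1 k, P ^ i).mulVec y)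
        Filter.atTop (nhds (J.mulVec y)) := by
    intro y
    have hLJ : L.mulVec (J.mulVec y) = 0 := by
      have hmem : J.mulVec y ∈ LinearMap.ker (L ^ ν).mulVecLin := hJr ▸ ⟨y, rfl⟩
      exact mulVec_eq_zero_of_pow_mulVec_eq_zero hτ hcontr ν hmem
    have hfix : P.mulVec (J.mulVec y) = J.mulVec y := by
      rw [hP, Matrix.sub_mulVec, Matrix.one_mulVec, Matrix.smul_mulVec, hLJ, smul_zero, sub_zero]
    obtain ⟨w, hw⟩ : y - J.mulVec y ∈ LinearMap.range L.mulVecLin := by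
      refine range_pow_mulVecLin_le hν.1 (hJk ▸ ?_)
      rw [LinearMap.mem_ker, Matrix.mulVecLin_apply, Matrix.mulVec_sub, Matrix.mulVec_mulVec, hJ2,
        sub_self]
    have hy : y = J.mulVec y + L.mulVec w := by
      rw [← Matrix.mulVecLin_apply L, hw]; abel
    have hlim := (tendsto_cesaro_pow_mulVec_of_mulVec_eq_self hfix).add
      (hP ▸ tendsto_cesaro_pow_mulVec_mulVec hτ hcontr w)
    simpa only [← Matrix.mulVec_add, ← hy, add_zero] using hlim
  refine ⟨tendsto_pi_nhds.2 fun i => tendsto_pi_nhds.2 fun j => ?_, hvec⟩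
  simpa only [Matrix.mulVec_single_one, Matrix.col_apply] using
    tendsto_pi_nhds.1 (hvec (Pi.single j 1)) i
end

section
/- Let P := I − τL with 0 < τ and the strict inequality τ·∑_{j≠i} a_{ij} < 1 for every i. Then the powers P^k converge entrywise, as k → ∞, to the eigenprojection J̃ of L; in particular, for every y(0) ∈ ℝⁿ, lim_{k→∞} P^k y(0) = J̃·y(0). -/
/-- A nonnegative matrix with unit row sums preserves upper bounds of vectors. -/
lemma mulVec_le_of_rowStochastic {ι : Type*} [Fintype ι] {P : Matrix ι ι ℝ}
    (h0 : ∀ i j, 0 ≤ P i j) (h1 : ∀ i, ∑ j, P i j = 1) {x : ι → ℝ} {b : ℝ}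
    (hx : ∀ i, x i ≤ b) (i : ι) : P.mulVec x i ≤ b := by
  calc P.mulVec x i = ∑ j, P i j * x j := rfl
    _ ≤ ∑ j, P i j * b := Finset.sum_le_sum fun j _ => mul_le_mul_of_nonneg_left (hx j) (h0 i j)
    _ = b := by rw [← Finset.sum_mul, h1, one_mul]

lemma pow_succ_mulVec {ι : Type*} [Fintype ι] [DecidableEq ι] (P : Matrix ι ι ℝ)
    (x : ι → ℝ) (k : ℕ) : (P ^ (k + 1)).mulVec x = P.mulVec ((P ^ k).mulVec x) := by
  rw [pow_succ', Matrix.mulVec_mulVec]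

lemma pow_mulVec_le_of_rowStochastic {ι : Type*} [Fintype ι] [DecidableEq ι] {P : Matrix ι ι ℝ}
    (h0 : ∀ i j, 0 ≤ P i j) (h1 : ∀ i, ∑ j, P i j = 1) {x : ι → ℝ} {b : ℝ}
    (hx : ∀ i, x i ≤ b) (k : ℕ) : ∀ i, (P ^ k).mulVec x i ≤ b := by
  induction k with
  | zero => simpa using hx
  | succ k ih =>
    intro i
    rw [pow_succ_mulVec]
    exact mulVec_le_of_rowStochastic h0 h1 ih i

/-- The orbits of a row-stochastic matrix are bounded. -/
lemma exists_abs_pow_mulVec_le {ι : Type*} [Fintype ι] [DecidableEq ι] {P : Matrix ι ι ℝ}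
    (h0 : ∀ i j, 0 ≤ P i j) (h1 : ∀ i, ∑ j, P i j = 1) (x : ι → ℝ) :
    ∃ B, ∀ k i, |(P ^ k).mulVec x i| ≤ B := by
  refine ⟨∑ j, |x j|, fun k i => ?_⟩
  have hb : ∀ j, |x j| ≤ ∑ j, |x j| := fun j =>
    Finset.single_le_sum (f := fun j => |x j|) (fun j _ => abs_nonneg _) (Finset.mem_univ j)
  rw [abs_le]
  constructor
  · have := pow_mulVec_le_of_rowStochastic h0 h1 (x := -x)
      (fun j => (neg_le_abs (x j)).trans (hb j)) k i
    rw [Matrix.mulVec_neg, Pi.neg_apply] at this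
    linarith
  · exact pow_mulVec_le_of_rowStochastic h0 h1 (fun j => (le_abs_self (x j)).trans (hb j)) k i

/-- For a row-stochastic matrix with positive diagonal, the increments along an orbit are
eventually bounded above by any positive constant. -/
lemma exists_increment_lt {ι : Type*} [Fintype ι] [DecidableEq ι] [Nonempty ι]
    {P : Matrix ι ι ℝ} (h0 : ∀ i j, 0 ≤ P i j) (h1 : ∀ i, ∑ j, P i j = 1)
    (hd : ∀ i, 0 < P i i) (x : ι → ℝ) {η : ℝ} (hη : 0 < η) :
    ∃ m, ∀ i, (P ^ m).mulVec (P.mulVec x - x) i < η := by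
  by_contra! hcon
  obtain ⟨B, hB⟩ := exists_abs_pow_mulVec_le h0 h1 x
  obtain ⟨i₀, hi₀⟩ := Finite.exists_min fun i => P i i
  set δ := P i₀ i₀ with hδdef
  have hδ : 0 < δ := hd i₀
  have hδ1 : δ ≤ 1 := by
    rw [← h1 i₀]
    exact Finset.single_le_sum (fun j _ => h0 i₀ j) (Finset.mem_univ i₀)
  set d : ℕ → ι → ℝ := fun k => (P ^ k).mulVec (P.mulVec x - x) with hd_def
  have hdx : ∀ k i, d k i = (P ^ (k + 1)).mulVec x i - (P ^ k).mulVec x i := by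
    intro k i
    simp only [hd_def, Matrix.mulVec_sub, Matrix.mulVec_mulVec, ← pow_succ, Pi.sub_apply]
  have hds : ∀ k, d (k + 1) = P.mulVec (d k) := fun k => pow_succ_mulVec P _ k
  set a : ℕ → ℝ := fun k => ⨆ i, d k i with ha
  have hda : ∀ k i, d k i ≤ a k := fun k i => le_ciSup (Finite.bddAbove_range (d k)) i
  have haη : ∀ k, η ≤ a k := fun k => by
    obtain ⟨i, hi⟩ := hcon k
    exact hi.trans (hda k i)
  set c := ⨅ k, a k with hc
  have hbdd : BddBelow (Set.range a) := ⟨η, by rintro _ ⟨k, rfl⟩; exact haη k⟩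
  have hca : ∀ k, c ≤ a k := fun k => ciInf_le hbdd k
  have hcη : η ≤ c := le_ciInf haη
  have hc0 : 0 < c := hη.trans_le hcη
  obtain ⟨N, hN⟩ := exists_nat_gt (2 * B / (c / 2))
  rw [div_lt_iff₀ (by positivity)] at hN
  set ε := δ ^ N * (c / 2) with hε
  have hε0 : 0 < ε := by positivity
  obtain ⟨m, hm⟩ := exists_lt_of_ciInf_lt (show c < c + ε by linarith)
  have hdm : ∀ t j, d (m + t) j ≤ c + ε := by
    intro t
    induction t with
    | zero => exact fun j => (hda m j).trans hm.le
    | succ t ih =>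
      intro j
      rw [← add_assoc, hds]
      exact mulVec_le_of_rowStochastic h0 h1 ih j
  obtain ⟨i, hi⟩ := exists_eq_ciSup_of_finite (f := d (m + N))
  have hi' : c ≤ d (m + N) i := by rw [hi]; exact hca _
  have hstep : ∀ t, δ * (c + ε - d (m + t) i) ≤ c + ε - d (m + (t + 1)) i := by
    intro t
    have hsum : c + ε - d (m + (t + 1)) i = ∑ j, P i j * (c + ε - d (m + t) j) := by
      rw [← add_assoc, hds]
      simp only [mul_sub, Finset.sum_sub_distrib, ← Finset.sum_mul, h1, one_mul]
      rfl
    rw [hsum]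
    refine (mul_le_mul_of_nonneg_right (hi₀ i) (sub_nonneg.2 (hdm t i))).trans ?_
    exact Finset.single_le_sum (f := fun j => P i j * (c + ε - d (m + t) j))
      (fun j _ => mul_nonneg (h0 i j) (sub_nonneg.2 (hdm t j))) (Finset.mem_univ i)
  have hback : ∀ s t, δ ^ s * (c + ε - d (m + t) i) ≤ c + ε - d (m + (t + s)) i := by
    intro s t
    induction s with
    | zero => simp
    | succ s ih =>
      calc δ ^ (s + 1) * (c + ε - d (m + t) i) = δ * (δ ^ s * (c + ε - d (m + t) i)) := by ring
        _ ≤ δ * (c + ε - d (m + (t + s)) i) := mul_le_mul_of_nonneg_left ih hδ.le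
        _ ≤ _ := hstep (t + s)
  have hlow : ∀ t ≤ N, c / 2 ≤ d (m + t) i := by
    intro t ht
    have hb := hback (N - t) t
    rw [Nat.add_sub_cancel' ht] at hb
    have hp : δ ^ N ≤ δ ^ (N - t) := pow_le_pow_of_le_one hδ.le hδ1 (Nat.sub_le N t)
    have hmul := mul_le_mul_of_nonneg_right hp (sub_nonneg.2 (hdm t i))
    have hle : δ ^ N * (c + ε - d (m + t) i) ≤ δ ^ N * (c / 2) := by linarith
    have := le_of_mul_le_mul_left hle (by positivity)
    linarith
  have hgrow : ∀ t ≤ N, t * (c / 2) ≤ (P ^ (m + t)).mulVec x i - (P ^ m).mulVec x i := by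
    intro t
    induction t with
    | zero => simp
    | succ t ih =>
      intro ht
      have h₁ := ih (by omega)
      have h₂ := hlow t (by omega)
      rw [hdx] at h₂
      push_cast
      rw [← add_assoc]
      linarith
  have h₁ := hgrow N le_rfl
  have h₂ := abs_le.1 (hB (m + N) i)
  have h₃ := abs_le.1 (hB m i)
  linarith

open Filter Topology in
/-- A row-stochastic matrix with positive diagonal is asymptotically regular. -/
lemma tendsto_pow_mulVec_increment {ι : Type*} [Fintype ι] [DecidableEq ι]
    {P : Matrix ι ι ℝ} (h0 : ∀ i j, 0 ≤ P i j) (h1 : ∀ i, ∑ j, P i j = 1)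
    (hd : ∀ i, 0 < P i i) (x : ι → ℝ) :
    Tendsto (fun k : ℕ => (P ^ k).mulVec (P.mulVec x - x)) atTop (𝓝 0) := by
  have key : ∀ (y : ι → ℝ) (η : ℝ), 0 < η → ∀ i : ι,
      ∀ᶠ k in atTop, (P ^ k).mulVec (P.mulVec y - y) i ≤ η := by
    intro y η hη i
    have : Nonempty ι := ⟨i⟩
    obtain ⟨m, hm⟩ := exists_increment_lt h0 h1 hd y hη
    filter_upwards [eventually_ge_atTop m] with k hk
    have := pow_mulVec_le_of_rowStochastic h0 h1 (fun j => (hm j).le) (k - m) i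
    rwa [Matrix.mulVec_mulVec, ← pow_add, Nat.sub_add_cancel hk] at this
  rw [tendsto_pi_nhds]
  intro i
  rw [Metric.tendsto_nhds]
  intro η hη
  filter_upwards [key x (η / 2) (by positivity) i, key (-x) (η / 2) (by positivity) i]
    with k hk₁ hk₂
  rw [show P.mulVec (-x) - -x = -(P.mulVec x - x) by rw [Matrix.mulVec_neg]; abel,
    Matrix.mulVec_neg, Pi.neg_apply] at hk₂
  rw [Pi.zero_apply, Real.dist_eq, sub_zero, abs_lt]
  constructor <;> linarith

/-- If `1 - τ • L` is row-stochastic then `0` is a semisimple eigenvalue of `L`. -/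
lemma mulVec_eq_zero_of_mulVec_mulVec_eq_zero_s2 {ι : Type*} [Fintype ι] [DecidableEq ι]
    {P L : Matrix ι ι ℝ} {τ : ℝ} (hτ : 0 < τ) (hP : P = 1 - τ • L)
    (h0 : ∀ i j, 0 ≤ P i j) (h1 : ∀ i, ∑ j, P i j = 1) {v : ι → ℝ}
    (hv : L.mulVec (L.mulVec v) = 0) : L.mulVec v = 0 := by
  obtain ⟨B, hB⟩ := exists_abs_pow_mulVec_le h0 h1 v
  have hk : ∀ k : ℕ, (P ^ k).mulVec v = v - (k * τ) • L.mulVec v := by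
    intro k
    induction k with
    | zero => simp
    | succ k ih =>
      rw [pow_succ_mulVec, ih, hP]
      simp only [Matrix.sub_mulVec, Matrix.mulVec_sub, Matrix.one_mulVec, Matrix.mulVec_smul,
        Matrix.smul_mulVec, hv, smul_zero, sub_zero]
      push_cast
      module
  ext i
  by_contra hne
  have hpos : 0 < τ * |L.mulVec v i| := mul_pos hτ (abs_pos.2 hne)
  obtain ⟨k, hkk⟩ := exists_nat_gt (2 * B / (τ * |L.mulVec v i|))
  rw [div_lt_iff₀ hpos] at hkk
  have hki : (k * τ) * L.mulVec v i = (P ^ 0).mulVec v i - (P ^ k).mulVec v i := by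
    rw [hk k]; simp
  have habs := congrArg abs hki
  rw [abs_mul, abs_of_nonneg (by positivity : (0 : ℝ) ≤ k * τ)] at habs
  have := abs_sub ((P ^ 0).mulVec v i) ((P ^ k).mulVec v i)
  have h₂ := hB 0 i
  have h₃ := hB k i
  linarith


/-- Under the strict inequality, the powers of P = I − τL converge to the eigenprojection J̃. -/
theorem stmt2 {n : ℕ} (hn : 0 < n) (A L : Matrix (Fin n) (Fin n) ℝ)
    (hA : ∀ i j, 0 ≤ A i j)
    (hL : L = Matrix.diagonal (fun i => ∑ j, A i j) - A)
    (ν : ℕ) (hν : IsLeast {k : ℕ | (L ^ (k + 1)).rank = (L ^ k).rank} ν)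
    (J : Matrix (Fin n) (Fin n) ℝ)
    (hJ2 : J * J = J)
    (hJr : LinearMap.range J.mulVecLin = LinearMap.ker (L ^ ν).mulVecLin)
    (hJk : LinearMap.ker J.mulVecLin = LinearMap.range (L ^ ν).mulVecLin)
    (τ : ℝ) (hτ : 0 < τ)
    (hτ1 : ∀ i, τ * ∑ j ∈ Finset.univ.erase i, A i j < 1)
    (P : Matrix (Fin n) (Fin n) ℝ) (hP : P = 1 - τ • L) :
    Filter.Tendsto (fun k : ℕ => P ^ k) Filter.atTop (nhds J) ∧
      ∀ y₀ : Fin n → ℝ,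
        Filter.Tendsto (fun k : ℕ => (P ^ k).mulVec y₀) Filter.atTop (nhds (J.mulVec y₀)) := by
  have h1 : ∀ i, ∑ j, P i j = 1 := by
    intro i
    simp [hP, hL, Matrix.one_apply, Matrix.diagonal_apply, Finset.sum_sub_distrib, mul_sub,
      ← Finset.mul_sum]
  have hd : ∀ i, 0 < P i i := by
    intro i
    have := hτ1 i
    have hsum := Finset.add_sum_erase Finset.univ (A i) (Finset.mem_univ i)
    have hPi : P i i = 1 - τ * (∑ j, A i j - A i i) := by simp [hP, hL]
    rw [hPi, ← hsum, add_sub_cancel_left]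
    linarith
  have h0 : ∀ i j, 0 ≤ P i j := by
    intro i j
    by_cases hij : i = j
    · exact hij ▸ (hd i).le
    · simpa [hP, hL, hij] using mul_nonneg hτ.le (hA i j)
  have hvec : ∀ y₀ : Fin n → ℝ,
      Filter.Tendsto (fun k : ℕ => (P ^ k).mulVec y₀) Filter.atTop (nhds (J.mulVec y₀)) := by
    intro y
    have hker : ∀ k (w : Fin n → ℝ), (L ^ k).mulVec w = 0 → L.mulVec w = 0 := by
      intro k
      induction k with
      | zero => intro w hw; rw [pow_zero, Matrix.one_mulVec] at hw; simp [hw]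
      | succ k ih =>
        intro w hw
        rw [pow_succ, ← Matrix.mulVec_mulVec] at hw
        exact mulVec_eq_zero_of_mulVec_mulVec_eq_zero_s2 hτ hP h0 h1 (ih _ hw)
    have hJy : L.mulVec (J.mulVec y) = 0 := by
      have hmem : J.mulVec y ∈ LinearMap.ker (L ^ ν).mulVecLin := hJr ▸ ⟨y, rfl⟩
      exact hker ν _ hmem
    have hrest : ∃ u, L.mulVec u = y - J.mulVec y := by
      have hmem : y - J.mulVec y ∈ LinearMap.range (L ^ ν).mulVecLin := by
        rw [← hJk, LinearMap.mem_ker, Matrix.mulVecLin_apply, Matrix.mulVec_sub,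
          Matrix.mulVec_mulVec, hJ2, sub_self]
      obtain ⟨u, hu⟩ := hmem
      rw [Matrix.mulVecLin_apply] at hu
      rcases ν with _ | ν
      · have hrank : L.rank = n := by simpa using hν.1
        have htop : LinearMap.range L.mulVecLin = ⊤ :=
          Submodule.eq_top_of_finrank_eq (hrank.trans (by simp))
        exact LinearMap.range_eq_top.1 htop _
      · exact ⟨(L ^ ν).mulVec u, by rw [← hu, pow_succ', Matrix.mulVec_mulVec]⟩
    obtain ⟨u, hu⟩ := hrest
    have hPL : ∀ w, P.mulVec w - w = -(τ • L.mulVec w) := by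
      intro w
      rw [hP, Matrix.sub_mulVec, Matrix.one_mulVec, Matrix.smul_mulVec]
      abel
    have hfix : ∀ k : ℕ, (P ^ k).mulVec (J.mulVec y) = J.mulVec y := by
      intro k
      induction k with
      | zero => simp
      | succ k ih =>
        rw [pow_succ_mulVec, ih, ← sub_eq_zero, hPL, hJy, smul_zero, neg_zero]
    have hdecomp : ∀ k : ℕ, (P ^ k).mulVec y =
        J.mulVec y + (-τ⁻¹) • (P ^ k).mulVec (P.mulVec u - u) := by
      intro k
      rw [hPL, hu, ← Matrix.mulVec_smul, smul_neg, neg_smul, neg_neg, smul_smul,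
        inv_mul_cancel₀ hτ.ne', one_smul, Matrix.mulVec_sub, hfix]
      abel
    simp only [hdecomp]
    simpa using ((tendsto_pow_mulVec_increment h0 h1 hd u).const_smul (-τ⁻¹)).const_add
      (J.mulVec y)
  refine ⟨?_, hvec⟩
  refine tendsto_pi_nhds.2 fun i => tendsto_pi_nhds.2 fun j => ?_
  simpa using tendsto_pi_nhds.1 (hvec (Pi.single j 1)) i
end

section
/- The all-ones vector 1 does not belong to range(L); equivalently, range(L) ∩ span(1) = {0}, so the sum range(L) + span(1) is direct. -/
/-- The Laplacian of a nonnegative matrix is nonpositive at a minimal coordinate of its argument. -/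
theorem Matrix.laplacian_mulVec_nonpos_of_forall_le {ι : Type*} [Fintype ι] [DecidableEq ι]
    {A : Matrix ι ι ℝ} (hA : ∀ i j, 0 ≤ A i j) {x : ι → ℝ} {i : ι} (hi : ∀ j, x i ≤ x j) :
    (Matrix.diagonal (fun i => ∑ j, A i j) - A).mulVec x i ≤ 0 := by
  rw [Matrix.sub_mulVec, Pi.sub_apply, Matrix.mulVec_diagonal, sub_nonpos, Finset.sum_mul]
  exact Finset.sum_le_sum fun j _ => mul_le_mul_of_nonneg_left (hi j) (hA i j)

/-- 1 ∉ range(L); equivalently range(L) ∩ span(1) = {0}, so range(L) + span(1) is direct. -/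
theorem stmt4 {n : ℕ} (hn : 0 < n) (A L : Matrix (Fin n) (Fin n) ℝ)
    (hA : ∀ i j, 0 ≤ A i j)
    (hL : L = Matrix.diagonal (fun i => ∑ j, A i j) - A) :
    (fun _ => 1 : Fin n → ℝ) ∉ LinearMap.range L.mulVecLin ∧
      LinearMap.range L.mulVecLin ⊓ Submodule.span ℝ {(fun _ => 1 : Fin n → ℝ)} = ⊥ := by
  have : Nonempty (Fin n) := ⟨⟨0, hn⟩⟩
  have not_mem : (fun _ => 1 : Fin n → ℝ) ∉ LinearMap.range L.mulVecLin := by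
    rintro ⟨x, hx⟩
    obtain ⟨i, hi⟩ := Finite.exists_min x
    have hxi : L.mulVec x i = 1 := congrFun hx i
    have := Matrix.laplacian_mulVec_nonpos_of_forall_le hA hi
    rw [← hL, hxi] at this
    linarith
  have ne_zero : (fun _ => 1 : Fin n → ℝ) ≠ 0 := fun h => one_ne_zero (congrFun h ⟨0, hn⟩)
  exact ⟨not_mem, disjoint_iff.mp ((Submodule.disjoint_span_singleton' ne_zero).mpr not_mem)⟩
end

section
/- For every integer k ≥ 1, (P·S)^k = P^k·S. Consequently, the coordination algorithm x(k) = (P·S)^k·x(0) coincides with the orthogonal projection algorithm x(k) = P^k·S·x(0). -/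
/-- An idempotent matrix fixes, by left multiplication, every matrix whose range lies in its own. -/
theorem Matrix.mul_eq_of_range_le {R m n : Type*} [CommSemiring R] [Fintype m] [Fintype n]
    {S : Matrix m m R} {L : Matrix m n R} (hS : S * S = S)
    (h : LinearMap.range L.mulVecLin ≤ LinearMap.range S.mulVecLin) : S * L = L := by
  classical
  refine Matrix.ext_of_mulVec_single fun j => ?_
  obtain ⟨w, hw⟩ := h ⟨Pi.single j 1, rfl⟩
  simp only [Matrix.mulVecLin_apply] at hw
  rw [← Matrix.mulVec_mulVec, ← hw, Matrix.mulVec_mulVec, hS]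

theorem mul_pow_succ_eq_pow_succ_mul {M : Type*} [Monoid M] {p s : M} (h : s * (p * s) = p * s)
    (k : ℕ) : (p * s) ^ (k + 1) = p ^ (k + 1) * s := by
  induction k with
  | zero => simp
  | succ k ih => rw [pow_succ, ih, mul_assoc, h, ← mul_assoc, ← pow_succ]

/-- (P·S)^k = P^k·S for all k ≥ 1; hence x(k) = (P·S)^k·x(0) coincides with P^k·S·x(0). -/
theorem stmt6 {n : ℕ} (hn : 0 < n) (A L : Matrix (Fin n) (Fin n) ℝ)
    (hA : ∀ i j, 0 ≤ A i j)
    (hL : L = Matrix.diagonal (fun i => ∑ j, A i j) - A)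
    (S : Matrix (Fin n) (Fin n) ℝ)
    (hSidem : S * S = S) (hSsymm : S.transpose = S)
    (hSrange : LinearMap.range S.mulVecLin =
      LinearMap.range L.mulVecLin ⊔ Submodule.span ℝ {(fun _ => 1 : Fin n → ℝ)})
    (τ : ℝ) (hτ : 0 < τ)
    (hτ1 : ∀ i, τ * ∑ j ∈ Finset.univ.erase i, A i j ≤ 1)
    (P : Matrix (Fin n) (Fin n) ℝ) (hP : P = 1 - τ • L) :
    (∀ k : ℕ, 1 ≤ k → (P * S) ^ k = P ^ k * S) ∧
      ∀ k : ℕ, 1 ≤ k → ∀ x₀ : Fin n → ℝ,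
        ((P * S) ^ k).mulVec x₀ = (P ^ k * S).mulVec x₀ := by
  have hSL : S * L = L :=
    Matrix.mul_eq_of_range_le hSidem (hSrange ▸ le_sup_left)
  have hSPS : S * (P * S) = P * S := by
    rw [hP, sub_mul, mul_sub, one_mul, hSidem, Matrix.smul_mul, Matrix.mul_smul, ← mul_assoc, hSL]
  have key : ∀ k : ℕ, 1 ≤ k → (P * S) ^ k = P ^ k * S := by
    intro k hk
    obtain ⟨m, rfl⟩ := Nat.exists_eq_add_of_le' hk
    exact mul_pow_succ_eq_pow_succ_mul hSPS m
  exact ⟨key, fun k hk x₀ => by rw [key k hk]⟩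
end

section
/- Every eigenvector of L corresponding to a nonzero eigenvalue is an eigenvector of L̃ for the same eigenvalue: if λ ∈ ℂ, λ ≠ 0, and x ∈ ℂⁿ satisfies L·x = λ·x (L and L̃ viewed as complex matrices via the inclusion ℝ ⊆ ℂ), then L̃·x = λ·x. -/
/-- An idempotent matrix fixes every matrix whose range lies in its own range. -/
theorem Matrix.mul_eq_of_idem_of_range_le {m n R : Type*} [Fintype m] [Fintype n] [DecidableEq n]
    [CommSemiring R] {S : Matrix m m R} {L : Matrix m n R} (hS : S * S = S)
    (h : LinearMap.range L.mulVecLin ≤ LinearMap.range S.mulVecLin) : S * L = L := by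
  refine Matrix.ext_of_mulVec_single fun j => ?_
  obtain ⟨w, hw⟩ := h ⟨Pi.single j 1, rfl⟩
  rw [Matrix.mulVecLin_apply, Matrix.mulVecLin_apply] at hw
  rw [← Matrix.mulVec_mulVec, ← hw, Matrix.mulVec_mulVec, hS]

/-- Every eigenvector of L for a nonzero eigenvalue λ is an eigenvector of L̃ for λ. -/
theorem stmt8 {n : ℕ} (hn : 0 < n) (A L : Matrix (Fin n) (Fin n) ℝ)
    (hA : ∀ i j, 0 ≤ A i j)
    (hL : L = Matrix.diagonal (fun i => ∑ j, A i j) - A)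
    (S : Matrix (Fin n) (Fin n) ℝ)
    (hSidem : S * S = S) (hSsymm : S.transpose = S)
    (hSrange : LinearMap.range S.mulVecLin =
      LinearMap.range L.mulVecLin ⊔ Submodule.span ℝ {(fun _ => 1 : Fin n → ℝ)})
    (τ : ℝ) (hτ : 0 < τ)
    (hτ1 : ∀ i, τ * ∑ j ∈ Finset.univ.erase i, A i j ≤ 1)
    (Lt : Matrix (Fin n) (Fin n) ℝ) (hLt : Lt = τ⁻¹ • (1 - S) + L * S) :
    ∀ (μ : ℂ) (x : Fin n → ℂ), μ ≠ 0 →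
      (L.map Complex.ofReal).mulVec x = μ • x →
        (Lt.map Complex.ofReal).mulVec x = μ • x := by
  intro μ x hμ hx
  have hSL : S * L = L :=
    Matrix.mul_eq_of_idem_of_range_le hSidem (hSrange ▸ le_sup_left)
  have hSLc : S.map Complex.ofReal * L.map Complex.ofReal = L.map Complex.ofReal := by
    conv_rhs => rw [← hSL]
    exact (Matrix.map_mul (f := Complex.ofRealHom)).symm
  have hSx : (S.map Complex.ofReal).mulVec x = x := by
    refine smul_right_injective _ hμ ?_
    change μ • (S.map Complex.ofReal).mulVec x = μ • x
    rw [← Matrix.mulVec_smul, ← hx, Matrix.mulVec_mulVec, hSLc]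
  have hLtc : Lt.map Complex.ofReal = (τ⁻¹ : ℂ) • (1 - S.map Complex.ofReal) +
      L.map Complex.ofReal * S.map Complex.ofReal := by
    ext i j
    simp [hLt, Matrix.mul_apply, Matrix.one_apply, apply_ite Complex.ofReal]
  rw [hLtc, Matrix.add_mulVec, Matrix.smul_mulVec, Matrix.sub_mulVec, Matrix.one_mulVec,
    ← Matrix.mulVec_mulVec, hSx, sub_self, smul_zero, zero_add, hx]
end

section
/- Spectrum of L̃: let d be the algebraic multiplicity of 0 as an eigenvalue of L, i.e., write the characteristic polynomial of L as charpoly(L) = X^d·q with q(0) ≠ 0. Then d ≥ 1 and the characteristic polynomial of L̃ is charpoly(L̃) = X·(X − τ⁻¹)^{d−1}·q. In particular, 0 is a simple eigenvalue of L̃, τ⁻¹ is an eigenvalue of L̃ of algebraic multiplicity d−1 (when d > 1), and the remaining eigenvalues of L̃ are the nonzero eigenvalues of L with the same multiplicities. -/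
open scoped Matrix

open Polynomial in
theorem Matrix.X_pow_mul_charpoly_add_of_mul_eq_zero {R m : Type*} [CommRing R] [Fintype m]
    [DecidableEq m] (M N : Matrix m m R) (h : M * N = 0) :
    X ^ Fintype.card m * (M + N).charpoly = M.charpoly * N.charpoly := by
  have hprod : (X : R[X]) • (M + N).charmatrix = M.charmatrix * N.charmatrix := by
    have h0 : M.map (C : R → R[X]) * N.map C = 0 := by
      rw [← Matrix.map_mul, h]; simp
    have hadd : (M + N).map (C : R → R[X]) = M.map C + N.map C := by ext; simp
    simp only [Matrix.charmatrix, RingHom.mapMatrix_apply, hadd, Matrix.scalar_apply,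
      ← Matrix.smul_one_eq_diagonal, sub_mul, mul_sub, h0, Matrix.smul_mul, Matrix.mul_smul,
      one_mul, mul_one, smul_sub, smul_add]
    abel
  rw [Matrix.charpoly, Matrix.charpoly, Matrix.charpoly, ← Matrix.det_mul, ← hprod,
    Matrix.det_smul]

open Polynomial in
theorem Matrix.charpoly_smul_of_isIdempotentElem {K m : Type*} [Field K] [Fintype m]
    [DecidableEq m] {P : Matrix m m K} (hP : P * P = P) (c : K) :
    (c • P).charpoly =
      X ^ (Fintype.card m - P.rank) * (X - C c) ^ P.rank := by
  let f := Matrix.toLin' P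
  let b := Module.finBasis K (LinearMap.range f)
  let e := Pi.basisFun K m
  let U := LinearMap.toMatrix b e (LinearMap.range f).subtype
  let V := LinearMap.toMatrix e b f.rangeRestrict
  have hr : P.rank = Module.finrank K (LinearMap.range f) := rfl
  have hUV : U * V = P := by
    rw [← LinearMap.toMatrix_comp, LinearMap.subtype_comp_codRestrict]
    exact LinearMap.toMatrix'_toLin' P
  have hVU : V * U = 1 := by
    rw [← LinearMap.toMatrix_comp, ← LinearMap.toMatrix_id b]
    congr 1
    ext ⟨x, y, rfl⟩ : 2
    simp [f, hP]
  have hle : Fintype.card (Fin (Module.finrank K (LinearMap.range f))) ≤ Fintype.card m := by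
    rw [Fintype.card_fin, ← hr]
    exact P.rank_le_card_width
  rw [← hUV, ← Matrix.smul_mul, Matrix.charpoly_mul_comm_of_le _ _ hle, Matrix.mul_smul, hVU,
    hUV, Fintype.card_fin, ← hr, Matrix.smul_one_eq_diagonal, Matrix.charpoly_diagonal]
  simp [hr]

theorem Matrix.rank_add_rank_one_sub_of_isIdempotentElem {K m : Type*} [Field K] [Fintype m]
    [DecidableEq m] {P : Matrix m m K} (hP : P * P = P) :
    P.rank + (1 - P).rank = Fintype.card m := by
  have hf : IsIdempotentElem (Matrix.toLin' P) := by
    rw [IsIdempotentElem, Module.End.mul_eq_comp, ← Matrix.toLin'_mul, hP]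
  have hker := LinearMap.IsIdempotentElem.ker_eq_range_one_sub hf
  have h1 : (1 : Module.End K (m → K)) - Matrix.toLin' P = Matrix.toLin' (1 - P) := by
    rw [map_sub, Matrix.toLin'_one]; rfl
  have := LinearMap.finrank_range_add_finrank_ker (Matrix.toLin' P)
  rw [hker, h1, Module.finrank_fintype_fun_eq_card] at this
  exact this

/-- If `1 - τ L` is row stochastic for some `τ > 0`, then the kernel and the range of `L` intersect
trivially. -/
theorem Matrix.mulVec_eq_zero_of_mulVec_mulVec_eq_zero_of_stochastic {m : Type*} [Fintype m]
    [DecidableEq m] {L : Matrix m m ℝ} {τ : ℝ} (hτ : 0 < τ)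
    (hnonneg : ∀ i j, 0 ≤ (1 - τ • L) i j) (hrow : ∀ i, ∑ j, (1 - τ • L) i j = 1)
    {x : m → ℝ} (hx : L *ᵥ (L *ᵥ x) = 0) : L *ᵥ x = 0 := by
  set y := L *ᵥ x
  have hiter : ∀ k : ℕ, ∀ i, |x i - k * (τ * y i)| ≤ ‖x‖ := by
    intro k
    induction k with
    | zero => intro i; simpa using norm_le_pi_norm x i
    | succ k ih =>
      intro i
      have hstep : (1 - τ • L) *ᵥ (x - (k : ℝ) • τ • y) = x - ((k + 1 : ℕ) : ℝ) • τ • y := by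
        simp only [Matrix.mulVec_sub, Matrix.sub_mulVec, Matrix.smul_mulVec, Matrix.mulVec_smul,
          hx, Matrix.one_mulVec, smul_zero, sub_zero]
        push_cast
        rw [add_smul, one_smul]
        change x - τ • y - _ = _
        abel
      have hi := congrFun hstep i
      simp only [Pi.sub_apply, Pi.smul_apply, smul_eq_mul] at hi
      rw [← hi, Matrix.mulVec, dotProduct]
      calc |∑ j, (1 - τ • L) i j * (x - (k : ℝ) • τ • y) j|
          ≤ ∑ j, |(1 - τ • L) i j * (x - (k : ℝ) • τ • y) j| := Finset.abs_sum_le_sum_abs _ _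
        _ ≤ ∑ j, (1 - τ • L) i j * ‖x‖ := by
            refine Finset.sum_le_sum fun j _ => ?_
            rw [abs_mul, abs_of_nonneg (hnonneg i j)]
            exact mul_le_mul_of_nonneg_left (ih j) (hnonneg i j)
        _ = ‖x‖ := by rw [← Finset.sum_mul, hrow, one_mul]
  ext i
  by_contra hy
  have hpos : 0 < τ * |y i| := mul_pos hτ (abs_pos.mpr hy)
  obtain ⟨k, hk⟩ := exists_nat_gt (2 * ‖x‖ / (τ * |y i|))
  rw [div_lt_iff₀ hpos] at hk
  have h1 := hiter k i
  have h2 : |x i| ≤ ‖x‖ := norm_le_pi_norm x i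
  have h3 : |(k : ℝ) * (τ * y i)| = k * (τ * |y i|) := by
    rw [abs_mul, abs_mul, Nat.abs_cast, abs_of_pos hτ]
  have h4 : |(k : ℝ) * (τ * y i)| ≤ |x i| + |x i - k * (τ * y i)| := by
    have := abs_sub (x i) (x i - k * (τ * y i))
    rwa [sub_sub_cancel] at this
  linarith

/-- If the kernel of `f ^ 2` equals that of `f`, the algebraic and geometric multiplicities
of the eigenvalue `0` agree. -/
theorem LinearMap.finrank_ker_eq_rootMultiplicity_charpoly {K V : Type*} [Field K]
    [AddCommGroup V] [Module K V] [FiniteDimensional K V] (f : Module.End K V)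
    (h : ∀ x, f (f x) = 0 → f x = 0) :
    Module.finrank K (LinearMap.ker f) = f.charpoly.rootMultiplicity 0 := by
  have hk : ∀ (k : ℕ) (x : V), (f ^ k) x = 0 → f x = 0 := by
    intro k
    induction k with
    | zero => intro x hx; simp_all
    | succ k ih =>
      intro x hx
      rw [pow_succ, Module.End.mul_apply] at hx
      exact h x (ih _ hx)
  rw [← LinearMap.finrank_maxGenEigenspace_eq]
  suffices LinearMap.ker f = f.maxGenEigenspace 0 by rw [this]
  ext x
  rw [Module.End.mem_maxGenEigenspace, LinearMap.mem_ker]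
  simp only [zero_smul, sub_zero]
  exact ⟨fun hx => ⟨1, by simpa using hx⟩, fun ⟨k, hx⟩ => hk k x hx⟩


/-- Spectrum of L̃: if charpoly(L) = X^d·q with q(0) ≠ 0, then d ≥ 1 and
charpoly(L̃) = X·(X − τ⁻¹)^{d−1}·q. -/
theorem stmt10 {n : ℕ} (hn : 0 < n) (A L : Matrix (Fin n) (Fin n) ℝ)
    (hA : ∀ i j, 0 ≤ A i j)
    (hL : L = Matrix.diagonal (fun i => ∑ j, A i j) - A)
    (S : Matrix (Fin n) (Fin n) ℝ)
    (hSidem : S * S = S) (hSsymm : S.transpose = S)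
    (hSrange : LinearMap.range S.mulVecLin =
      LinearMap.range L.mulVecLin ⊔ Submodule.span ℝ {(fun _ => 1 : Fin n → ℝ)})
    (τ : ℝ) (hτ : 0 < τ)
    (hτ1 : ∀ i, τ * ∑ j ∈ Finset.univ.erase i, A i j ≤ 1)
    (Lt : Matrix (Fin n) (Fin n) ℝ) (hLt : Lt = τ⁻¹ • (1 - S) + L * S)
    (d : ℕ) (q : Polynomial ℝ) (hq0 : q.eval 0 ≠ 0)
    (hd : L.charpoly = Polynomial.X ^ d * q) :
    1 ≤ d ∧
      Lt.charpoly = Polynomial.X * (Polynomial.X - Polynomial.C τ⁻¹) ^ (d - 1) * q := by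
  have hL1 : L *ᵥ (fun _ => 1) = 0 := by
    ext i
    simp [hL, Matrix.mulVec, dotProduct, Matrix.diagonal_apply]
  have hss : ∀ x, L *ᵥ (L *ᵥ x) = 0 → L *ᵥ x = 0 := by
    intro x hx
    refine Matrix.mulVec_eq_zero_of_mulVec_mulVec_eq_zero_of_stochastic hτ ?_ ?_ hx
    · intro i j
      rcases eq_or_ne i j with rfl | hij
      · have h := hτ1 i
        have hs := Finset.add_sum_erase Finset.univ (fun j => A i j) (Finset.mem_univ i)
        simp only [hL, Matrix.sub_apply, Matrix.smul_apply, Matrix.one_apply_eq,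
          Matrix.diagonal_apply_eq, smul_eq_mul, ← hs]
        linarith
      · simpa [hL, hij] using mul_nonneg hτ.le (hA i j)
    · intro i
      have h := congrFun hL1 i
      simp only [Matrix.mulVec, dotProduct, mul_one, Pi.zero_apply] at h
      simp only [Matrix.sub_apply, Matrix.smul_apply, smul_eq_mul, Finset.sum_sub_distrib,
        ← Finset.mul_sum, h]
      simp [Matrix.one_apply]
  have hdker : Module.finrank ℝ (LinearMap.ker L.mulVecLin) = d := by
    rw [LinearMap.finrank_ker_eq_rootMultiplicity_charpoly L.mulVecLin hss]
    have hc : L.mulVecLin.charpoly = L.charpoly := Matrix.charpoly_toLin' L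
    have hq : q ≠ 0 := by rintro rfl; simp at hq0
    rw [hc, hd,
      Polynomial.rootMultiplicity_mul (mul_ne_zero (pow_ne_zero _ Polynomial.X_ne_zero) hq),
      Polynomial.rootMultiplicity_eq_zero hq0, add_zero]
    simpa using Polynomial.rootMultiplicity_X_sub_C_pow (0 : ℝ) d
  have hrn := LinearMap.finrank_range_add_finrank_ker L.mulVecLin
  rw [hdker, Module.finrank_fin_fun] at hrn
  have h1 : (fun _ => 1 : Fin n → ℝ) ≠ 0 := fun h => one_ne_zero (congrFun h ⟨0, hn⟩)
  have hdisj : Disjoint (LinearMap.range L.mulVecLin)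
      (Submodule.span ℝ {(fun _ => 1 : Fin n → ℝ)}) := by
    rw [Submodule.disjoint_span_singleton' h1]
    rintro ⟨x, hx⟩
    rw [Matrix.mulVecLin_apply] at hx
    exact h1 (hx ▸ hss x (by rw [hx, hL1]))
  have hSrank : S.rank = Module.finrank ℝ (LinearMap.range L.mulVecLin) + 1 := by
    rw [Matrix.rank, hSrange, ← finrank_span_singleton (K := ℝ) h1,
      ← Submodule.finrank_sup_add_finrank_inf_eq, hdisj.eq_bot, finrank_bot, add_zero]
  have hcompl := Matrix.rank_add_rank_one_sub_of_isIdempotentElem hSidem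
  rw [Fintype.card_fin] at hcompl
  have hSL : S * L = L := by
    refine Matrix.ext_of_mulVec_single fun j => ?_
    have hmem : L *ᵥ Pi.single j 1 ∈ LinearMap.range S.mulVecLin := by
      rw [hSrange]
      exact Submodule.mem_sup_left ⟨_, rfl⟩
    obtain ⟨z, hz⟩ := hmem
    rw [Matrix.mulVecLin_apply] at hz
    rw [← Matrix.mulVec_mulVec, ← hz, Matrix.mulVec_mulVec, hSidem]
  have hPidem : (1 - S) * (1 - S) = 1 - S := IsIdempotentElem.one_sub hSidem
  have horth : (τ⁻¹ • (1 - S)) * (L * S) = 0 := by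
    rw [Matrix.smul_mul, ← Matrix.mul_assoc, sub_mul, hSL, one_mul, sub_self, zero_mul, smul_zero]
  have hdpos : 1 ≤ d := by omega
  have hrank : (1 - S).rank = d - 1 := by omega
  refine ⟨hdpos, ?_⟩
  have hmain := Matrix.X_pow_mul_charpoly_add_of_mul_eq_zero _ _ horth
  rw [← hLt, Matrix.charpoly_smul_of_isIdempotentElem hPidem, Matrix.charpoly_mul_comm L S, hSL,
    hd, hrank, Fintype.card_fin] at hmain
  refine mul_left_cancel₀ (pow_ne_zero n Polynomial.X_ne_zero) (hmain.trans ?_)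
  obtain ⟨e, rfl⟩ := Nat.exists_eq_add_of_le' hdpos
  obtain ⟨k, rfl⟩ : ∃ k, n = k + e := ⟨n - e, by omega⟩
  simp only [Nat.add_sub_cancel]
  ring
end

section
/- The matrix J̃·S is the eigenprojection of L̃ := τ⁻¹(I − S) + L·S corresponding to the eigenvalue 0: J̃·S is idempotent, rank(L̃²) = rank(L̃) (so the index of L̃ is at most 1), range(J̃·S) = null(L̃), and null(J̃·S) = range(L̃); in particular L̃·(J̃·S) = 0 and (J̃·S)·L̃ = 0. -/
namespace Matrix

variable {m : Type*} [Fintype m]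

theorem rank_eq_rank_of_ker_mulVecLin_eq {K : Type*} [Field K] {M N : Matrix m m K}
    (h : LinearMap.ker M.mulVecLin = LinearMap.ker N.mulVecLin) : M.rank = N.rank := by
  have hM := M.mulVecLin.finrank_range_add_finrank_ker
  have hN := N.mulVecLin.finrank_range_add_finrank_ker
  rw [h] at hM
  rw [Matrix.rank, Matrix.rank]
  omega

theorem mul_eq_self_of_idempotent_of_range_le [DecidableEq m] {K : Type*} [Field K]
    {P M : Matrix m m K}
    (hP : P * P = P)
    (h : LinearMap.range M.mulVecLin ≤ LinearMap.range P.mulVecLin) : P * M = M := by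
  refine ext_of_mulVec_single fun i => ?_
  obtain ⟨w, hw⟩ := h ⟨Pi.single i 1, rfl⟩
  simp only [mulVecLin_apply] at hw
  rw [← mulVec_mulVec, ← hw, mulVec_mulVec, hP]

/-- A nonnegative matrix with unit row sums does not increase the sup norm. -/
theorem norm_mulVec_le_of_row_sum_eq_one {P : Matrix m m ℝ} (hP : ∀ i j, 0 ≤ P i j)
    (hs : ∀ i, ∑ j, P i j = 1) (x : m → ℝ) : ‖P *ᵥ x‖ ≤ ‖x‖ := by
  refine (pi_norm_le_iff_of_nonneg (norm_nonneg x)).2 fun i => ?_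
  calc ‖∑ j, P i j * x j‖ ≤ ∑ j, ‖P i j * x j‖ := norm_sum_le _ _
    _ ≤ ∑ j, P i j * ‖x‖ := by
        refine Finset.sum_le_sum fun j _ => ?_
        rw [norm_mul, Real.norm_of_nonneg (hP i j)]
        exact mul_le_mul_of_nonneg_left (norm_le_pi_norm x j) (hP i j)
    _ = ‖x‖ := by rw [← Finset.sum_mul, hs, one_mul]

/-- If `1 - τ L` is row stochastic, then `L` has index at most one. -/
theorem mulVec_eq_zero_of_stochastic [DecidableEq m] {L : Matrix m m ℝ} {τ : ℝ} (hτ : 0 < τ)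
    (hP : ∀ i j, 0 ≤ (1 - τ • L) i j) (hs : ∀ i, ∑ j, (1 - τ • L) i j = 1)
    {x : m → ℝ} (hx : L *ᵥ (L *ᵥ x) = 0) : L *ᵥ x = 0 := by
  have hbound (k : ℕ) : ‖x - ((k : ℝ) * τ) • (L *ᵥ x)‖ ≤ ‖x‖ := by
    induction k with
    | zero => simp
    | succ k ih =>
      refine le_trans (le_of_eq ?_) ((norm_mulVec_le_of_row_sum_eq_one hP hs _).trans ih)
      congr 1
      rw [sub_mulVec, one_mulVec, smul_mulVec, mulVec_sub, mulVec_smul, hx, smul_zero, sub_zero]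
      push_cast
      module
  by_contra hne
  have hpos : 0 < τ * ‖L *ᵥ x‖ := mul_pos hτ (norm_pos_iff.2 hne)
  obtain ⟨k, hk⟩ := exists_nat_gt (2 * ‖x‖ / (τ * ‖L *ᵥ x‖))
  rw [div_lt_iff₀ hpos] at hk
  have h1 : ‖((k : ℝ) * τ) • (L *ᵥ x)‖ ≤ ‖x‖ + ‖x‖ := by
    have := norm_sub_le x (x - ((k : ℝ) * τ) • (L *ᵥ x))
    rw [sub_sub_cancel] at this
    exact this.trans (by gcongr; exact hbound k)
  rw [norm_smul, Real.norm_of_nonneg (by positivity)] at h1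
  linarith

theorem laplacian_mulVec_one [DecidableEq m] (A : Matrix m m ℝ) :
    (diagonal (fun i => ∑ j, A i j) - A) *ᵥ (fun _ => 1) = 0 := by
  ext i
  simp [mulVec, dotProduct, diagonal_apply]

theorem laplacian_mulVec_eq_zero_of_sq [DecidableEq m] {A : Matrix m m ℝ} (hA : ∀ i j, 0 ≤ A i j)
    {τ : ℝ} (hτ : 0 < τ) (hτ1 : ∀ i, τ * ∑ j ∈ Finset.univ.erase i, A i j ≤ 1) {x : m → ℝ}
    (hx : (diagonal (fun i => ∑ j, A i j) - A) *ᵥ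
      ((diagonal (fun i => ∑ j, A i j) - A) *ᵥ x) = 0) :
    (diagonal (fun i => ∑ j, A i j) - A) *ᵥ x = 0 := by
  refine mulVec_eq_zero_of_stochastic hτ (fun i j => ?_) (fun i => ?_) hx
  · by_cases hij : i = j
    · subst hij
      have h := hτ1 i
      rw [Finset.sum_erase_eq_sub (Finset.mem_univ i)] at h
      simpa using h
    · simpa [hij] using mul_nonneg hτ.le (hA i j)
  · have h := congrFun (laplacian_mulVec_one A) i
    simp only [mulVec, dotProduct, mul_one, Pi.zero_apply] at h
    simp only [sub_apply (1 : Matrix m m ℝ), smul_apply, smul_eq_mul, Finset.sum_sub_distrib,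
      ← Finset.mul_sum, h]
    simp [one_apply]

end Matrix


/-- J̃·S is the eigenprojection of L̃ corresponding to the eigenvalue 0. -/
theorem stmt11 {n : ℕ} (hn : 0 < n) (A L : Matrix (Fin n) (Fin n) ℝ)
    (hA : ∀ i j, 0 ≤ A i j)
    (hL : L = Matrix.diagonal (fun i => ∑ j, A i j) - A)
    (ν : ℕ) (hν : IsLeast {k : ℕ | (L ^ (k + 1)).rank = (L ^ k).rank} ν)
    (J : Matrix (Fin n) (Fin n) ℝ)
    (hJ2 : J * J = J)
    (hJr : LinearMap.range J.mulVecLin = LinearMap.ker (L ^ ν).mulVecLin)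
    (hJk : LinearMap.ker J.mulVecLin = LinearMap.range (L ^ ν).mulVecLin)
    (S : Matrix (Fin n) (Fin n) ℝ)
    (hSidem : S * S = S) (hSsymm : S.transpose = S)
    (hSrange : LinearMap.range S.mulVecLin =
      LinearMap.range L.mulVecLin ⊔ Submodule.span ℝ {(fun _ => 1 : Fin n → ℝ)})
    (τ : ℝ) (hτ : 0 < τ)
    (hτ1 : ∀ i, τ * ∑ j ∈ Finset.univ.erase i, A i j ≤ 1)
    (Lt : Matrix (Fin n) (Fin n) ℝ) (hLt : Lt = τ⁻¹ • (1 - S) + L * S) :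
    (J * S) * (J * S) = J * S ∧
      (Lt ^ 2).rank = Lt.rank ∧
      LinearMap.range (J * S).mulVecLin = LinearMap.ker Lt.mulVecLin ∧
      LinearMap.ker (J * S).mulVecLin = LinearMap.range Lt.mulVecLin ∧
      Lt * (J * S) = 0 ∧ (J * S) * Lt = 0 := by
  set e : Fin n → ℝ := fun _ => 1 with he
  have hLe : L.mulVec e = 0 := by rw [hL]; exact Matrix.laplacian_mulVec_one A
  have hsq {x : Fin n → ℝ} (hx : L.mulVec (L.mulVec x) = 0) : L.mulVec x = 0 := by
    rw [hL] at hx ⊢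
    exact Matrix.laplacian_mulVec_eq_zero_of_sq hA hτ hτ1 hx
  have hν1 : ν = 1 := by
    have hle : ν ≤ 1 := hν.2 <| Matrix.rank_eq_rank_of_ker_mulVecLin_eq <| by
      ext x
      simp only [LinearMap.mem_ker, Matrix.mulVecLin_apply, pow_succ, pow_zero, one_mul,
        ← Matrix.mulVec_mulVec]
      exact ⟨hsq, fun h => by rw [h, Matrix.mulVec_zero]⟩
    have hne : ν ≠ 0 := by
      rintro rfl
      have hr : L.rank = n := by simpa using hν.1
      have hk := L.mulVecLin.finrank_range_add_finrank_ker
      rw [← Matrix.rank, hr, Module.finrank_fin_fun, Nat.add_eq_left,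
        Submodule.finrank_eq_zero] at hk
      have hmem : e ∈ LinearMap.ker L.mulVecLin := hLe
      rw [hk, Submodule.mem_bot] at hmem
      exact one_ne_zero (congrFun hmem ⟨0, hn⟩)
    omega
  rw [hν1, pow_one] at hJr hJk
  have hJfix {x : Fin n → ℝ} (hx : L.mulVec x = 0) : J.mulVec x = x := by
    have hmem : x ∈ LinearMap.range J.mulVecLin := hJr ▸ hx
    obtain ⟨w, rfl⟩ := hmem
    simp only [Matrix.mulVecLin_apply, Matrix.mulVec_mulVec, hJ2]
  have hLJ : L * J = 0 := Matrix.ext_of_mulVec_single fun i => by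
    have hmem : J.mulVec (Pi.single i 1) ∈ LinearMap.ker L.mulVecLin := hJr ▸ ⟨_, rfl⟩
    rw [← Matrix.mulVec_mulVec, Matrix.zero_mulVec]
    exact hmem
  have hJL : J * L = 0 := Matrix.ext_of_mulVec_single fun i => by
    have hmem : L.mulVec (Pi.single i 1) ∈ LinearMap.ker J.mulVecLin := hJk ▸ ⟨_, rfl⟩
    rw [← Matrix.mulVec_mulVec, Matrix.zero_mulVec]
    exact hmem
  have hSL : S * L = L :=
    Matrix.mul_eq_self_of_idempotent_of_range_le hSidem (hSrange ▸ le_sup_left)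
  have hSe : S.mulVec e = e := by
    have hmem : e ∈ LinearMap.range S.mulVecLin :=
      hSrange ▸ Submodule.mem_sup_right (Submodule.mem_span_singleton_self _)
    obtain ⟨w, hw⟩ := hmem
    rw [← hw, Matrix.mulVecLin_apply, Matrix.mulVec_mulVec, hSidem]
  have hSJS : S * (J * S) = J * S := Matrix.ext_of_mulVec_single fun i => by
    have hmem : S.mulVec (Pi.single i 1) ∈
        LinearMap.range L.mulVecLin ⊔ Submodule.span ℝ {e} := hSrange ▸ ⟨_, rfl⟩
    obtain ⟨_, ⟨w, rfl⟩, _, hz, hsum⟩ := Submodule.mem_sup.1 hmem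
    obtain ⟨c, rfl⟩ := Submodule.mem_span_singleton.1 hz
    simp only [← Matrix.mulVec_mulVec, ← hsum, Matrix.mulVecLin_apply, Matrix.mulVec_add,
      Matrix.mulVec_smul, hJfix hLe, hSe]
    simp [Matrix.mulVec_mulVec, hJL]
  have hidem : (J * S) * (J * S) = J * S := by
    rw [Matrix.mul_assoc, hSJS, ← Matrix.mul_assoc, hJ2]
  have hLtJS : Lt * (J * S) = 0 := by
    rw [hLt, Matrix.add_mul, Matrix.smul_mul, Matrix.sub_mul, Matrix.one_mul, hSJS,
      Matrix.mul_assoc, hSJS, ← Matrix.mul_assoc, hLJ]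
    simp
  have hJSLt : (J * S) * Lt = 0 := by
    have h : (J * S) * (L * S) = 0 := by
      rw [Matrix.mul_assoc, ← Matrix.mul_assoc S, hSL, ← Matrix.mul_assoc, hJL, Matrix.zero_mul]
    rw [hLt, Matrix.mul_add, h, Matrix.mul_smul, Matrix.mul_sub, Matrix.mul_one,
      Matrix.mul_assoc J, hSidem]
    simp
  have hfix {x : Fin n → ℝ} (hx : Lt.mulVec x = 0) : (J * S).mulVec x = x := by
    have hSLt : S * Lt = L * S := by
      rw [hLt, Matrix.mul_add, Matrix.mul_smul, Matrix.mul_sub, Matrix.mul_one, hSidem,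
        ← Matrix.mul_assoc, hSL]
      simp
    have hLS : (L * S).mulVec x = 0 := by
      rw [← hSLt, ← Matrix.mulVec_mulVec, hx, Matrix.mulVec_zero]
    have hSx : S.mulVec x = x := by
      rw [hLt, Matrix.add_mulVec, hLS, add_zero, Matrix.smul_mulVec, Matrix.sub_mulVec,
        Matrix.one_mulVec] at hx
      exact (sub_eq_zero.1 ((smul_eq_zero.1 hx).resolve_left (inv_ne_zero hτ.ne'))).symm
    rw [← Matrix.mulVec_mulVec, hSx] at hLS ⊢
    exact hJfix hLS
  have hrange : LinearMap.range (J * S).mulVecLin = LinearMap.ker Lt.mulVecLin := by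
    refine le_antisymm ?_ fun x hx => ⟨x, hfix hx⟩
    rintro _ ⟨x, rfl⟩
    simp only [LinearMap.mem_ker, Matrix.mulVecLin_apply, Matrix.mulVec_mulVec, hLtJS,
      Matrix.zero_mulVec]
  refine ⟨hidem, Matrix.rank_eq_rank_of_ker_mulVecLin_eq ?_, hrange, ?_, hLtJS, hJSLt⟩
  · ext x
    simp only [LinearMap.mem_ker, Matrix.mulVecLin_apply, pow_two, ← Matrix.mulVec_mulVec]
    refine ⟨fun h => ?_, fun h => by rw [h, Matrix.mulVec_zero]⟩
    rw [← hfix h, Matrix.mulVec_mulVec, hJSLt, Matrix.zero_mulVec]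
  · symm
    refine Submodule.eq_of_le_of_finrank_eq ?_ ?_
    · rintro _ ⟨x, rfl⟩
      simp only [LinearMap.mem_ker, Matrix.mulVecLin_apply, Matrix.mulVec_mulVec, hJSLt,
        Matrix.zero_mulVec]
    · have h1 := (J * S).mulVecLin.finrank_range_add_finrank_ker
      have h2 := Lt.mulVecLin.finrank_range_add_finrank_ker
      rw [hrange] at h1
      omega
end

section
/- Every y ∈ ℝⁿ with S·y = 0 satisfies L̃·L̃ᵀ·y = τ⁻²·y, where L̃ᵀ is the transpose of L̃ := τ⁻¹(I − S) + L·S. Consequently, if the null space of S is nontrivial, then τ⁻¹ is a singular value of L̃, and the τ⁻²-eigenspace of L̃·L̃ᵀ contains null(S). -/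
open Matrix in
/-- An idempotent matrix fixes from the left any matrix whose range its own range contains. -/
theorem Matrix.mul_eq_of_range_mulVecLin_le {R m k : Type*} [CommSemiring R] [Fintype m]
    [Fintype k] {P : Matrix m m R} {B : Matrix m k R} (hP : P * P = P)
    (h : LinearMap.range B.mulVecLin ≤ LinearMap.range P.mulVecLin) : P * B = B := by
  classical
  refine Matrix.ext_of_mulVec_single fun i => ?_
  obtain ⟨z, hz⟩ := h ⟨Pi.single i 1, rfl⟩
  simp only [mulVecLin_apply] at hz
  rw [← mulVec_mulVec, ← hz, mulVec_mulVec, hP]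

/-- Every y with S·y = 0 satisfies L̃·L̃ᵀ·y = τ⁻²·y; hence if null(S) ≠ 0 then
τ⁻¹ is a singular value of L̃. -/
theorem stmt12 {n : ℕ} (hn : 0 < n) (A L : Matrix (Fin n) (Fin n) ℝ)
    (hA : ∀ i j, 0 ≤ A i j)
    (hL : L = Matrix.diagonal (fun i => ∑ j, A i j) - A)
    (S : Matrix (Fin n) (Fin n) ℝ)
    (hSidem : S * S = S) (hSsymm : S.transpose = S)
    (hSrange : LinearMap.range S.mulVecLin =
      LinearMap.range L.mulVecLin ⊔ Submodule.span ℝ {(fun _ => 1 : Fin n → ℝ)})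
    (τ : ℝ) (hτ : 0 < τ)
    (hτ1 : ∀ i, τ * ∑ j ∈ Finset.univ.erase i, A i j ≤ 1)
    (Lt : Matrix (Fin n) (Fin n) ℝ) (hLt : Lt = τ⁻¹ • (1 - S) + L * S) :
    (∀ y : Fin n → ℝ, S.mulVec y = 0 → (Lt * Lt.transpose).mulVec y = (τ ^ 2)⁻¹ • y) ∧
      (LinearMap.ker S.mulVecLin ≠ ⊥ →
        ∃ y : Fin n → ℝ, y ≠ 0 ∧ (Lt * Lt.transpose).mulVec y = (τ ^ 2)⁻¹ • y) := by
  have hSL : S * L = L :=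
    Matrix.mul_eq_of_range_mulVecLin_le hSidem (hSrange ▸ le_sup_left)
  have key : ∀ y : Fin n → ℝ, S.mulVec y = 0 →
      (Lt * Lt.transpose).mulVec y = (τ ^ 2)⁻¹ • y := by
    intro y hy
    have hLy : L.transpose.mulVec y = 0 := by
      rw [← hSL, Matrix.transpose_mul, hSsymm, ← Matrix.mulVec_mulVec, hy, Matrix.mulVec_zero]
    have hLt_y : Lt.mulVec y = τ⁻¹ • y := by
      simp [hLt, Matrix.add_mulVec, Matrix.smul_mulVec, Matrix.sub_mulVec,
        ← Matrix.mulVec_mulVec, hy]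
    have hLtT_y : Lt.transpose.mulVec y = τ⁻¹ • y := by
      simp [hLt, Matrix.add_mulVec, Matrix.smul_mulVec, Matrix.sub_mulVec,
        ← Matrix.mulVec_mulVec, hy, hSsymm, hLy]
    rw [← Matrix.mulVec_mulVec, hLtT_y, Matrix.mulVec_smul, hLt_y, smul_smul, ← sq, inv_pow]
  refine ⟨key, fun hker => ?_⟩
  obtain ⟨y, hy, hy0⟩ := Submodule.exists_mem_ne_zero_of_ne_bot hker
  exact ⟨y, hy0, key y hy⟩
end

section
/- Write L̃(τ) := τ⁻¹(I − S) + L·S for τ > 0. If the subspace range(L) + span(1) is a proper subspace of ℝⁿ (equivalently S ≠ I), then the function τ ↦ ‖L̃(τ) − L‖_F is strictly decreasing on (0, ∞), and its infimum over τ > 0 equals ‖L·S − L‖_F. -/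
/-- A square matrix with columns in the range of an idempotent is fixed by that idempotent. -/
theorem Matrix.mul_eq_right_of_range_le {n R : Type*} [Fintype n] [DecidableEq n] [CommRing R]
    {S L : Matrix n n R} (hS : S * S = S)
    (h : LinearMap.range L.mulVecLin ≤ LinearMap.range S.mulVecLin) : S * L = L := by
  refine Matrix.ext_of_mulVec_single fun i => ?_
  obtain ⟨w, hw⟩ := h ⟨Pi.single i 1, rfl⟩
  simp only [Matrix.mulVecLin_apply] at hw
  rw [← Matrix.mulVec_mulVec, ← hw, Matrix.mulVec_mulVec, hS]

/-- Pythagoras for the entrywise inner product of matrices. -/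
theorem Matrix.sum_sq_smul_add_of_trace_eq_zero {n : Type*} [Fintype n]
    {P M : Matrix n n ℝ} (h : (P.transpose * M).trace = 0) (t : ℝ) :
    ∑ i, ∑ j, ((t • P + M) i j) ^ 2 =
      t ^ 2 * ∑ i, ∑ j, P i j ^ 2 + ∑ i, ∑ j, M i j ^ 2 := by
  have h' : ∑ i, ∑ j, P i j * M i j = 0 := by
    rw [Finset.sum_comm, ← h]
    simp [Matrix.trace, Matrix.mul_apply]
  calc ∑ i, ∑ j, ((t • P + M) i j) ^ 2
      = ∑ i, ∑ j, (t ^ 2 * P i j ^ 2 + 2 * t * (P i j * M i j) + M i j ^ 2) := by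
        refine Finset.sum_congr rfl fun i _ => Finset.sum_congr rfl fun j _ => ?_
        simp only [Matrix.add_apply, Matrix.smul_apply, smul_eq_mul]
        ring
    _ = _ := by
        simp only [Finset.sum_add_distrib, ← Finset.mul_sum, h', mul_zero, add_zero]

theorem Matrix.sum_sq_pos_of_ne_zero {n : Type*} [Fintype n] {P : Matrix n n ℝ} (hP : P ≠ 0) :
    0 < ∑ i, ∑ j, P i j ^ 2 := by
  obtain ⟨i, j, hij⟩ : ∃ i j, P i j ≠ 0 := by
    by_contra! h
    exact hP (Matrix.ext h)
  exact Finset.sum_pos' (fun _ _ => Finset.sum_nonneg fun _ _ => sq_nonneg _)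
    ⟨i, Finset.mem_univ i, Finset.sum_pos' (fun _ _ => sq_nonneg _)
      ⟨j, Finset.mem_univ j, by positivity⟩⟩

/-- If range(L) + span(1) is proper (S ≠ I), then τ ↦ ‖L̃(τ) − L‖_F is strictly
decreasing on (0, ∞) and its infimum is ‖L·S − L‖_F. -/
theorem stmt17 {n : ℕ} (hn : 0 < n) (A L : Matrix (Fin n) (Fin n) ℝ)
    (hA : ∀ i j, 0 ≤ A i j)
    (hL : L = Matrix.diagonal (fun i => ∑ j, A i j) - A)
    (S : Matrix (Fin n) (Fin n) ℝ)
    (hSidem : S * S = S) (hSsymm : S.transpose = S)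
    (hSrange : LinearMap.range S.mulVecLin =
      LinearMap.range L.mulVecLin ⊔ Submodule.span ℝ {(fun _ => 1 : Fin n → ℝ)})
    (hSne : S ≠ 1) :
    StrictAntiOn
        (fun τ : ℝ => Real.sqrt (∑ i, ∑ j, ((τ⁻¹ • (1 - S) + L * S - L) i j) ^ 2))
        (Set.Ioi 0) ∧
      IsGLB
        ((fun τ : ℝ => Real.sqrt (∑ i, ∑ j, ((τ⁻¹ • (1 - S) + L * S - L) i j) ^ 2)) ''
          Set.Ioi 0)
        (Real.sqrt (∑ i, ∑ j, ((L * S - L) i j) ^ 2)) := by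
  have hSL : S * L = L :=
    Matrix.mul_eq_right_of_range_le hSidem (hSrange ▸ le_sup_left)
  have htr : ((1 - S).transpose * (L * S - L)).trace = 0 := by
    rw [Matrix.transpose_sub, Matrix.transpose_one, hSsymm, sub_mul, one_mul, mul_sub,
      ← mul_assoc, hSL, sub_self, Matrix.trace_zero]
  have hp := Matrix.sum_sq_pos_of_ne_zero (sub_ne_zero.mpr hSne.symm)
  have hm : 0 ≤ ∑ i, ∑ j, (L * S - L) i j ^ 2 :=
    Finset.sum_nonneg fun _ _ => Finset.sum_nonneg fun _ _ => sq_nonneg _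
  simp only [add_sub_assoc, Matrix.sum_sq_smul_add_of_trace_eq_zero htr]
  set p := ∑ i, ∑ j, (1 - S) i j ^ 2
  set m := ∑ i, ∑ j, (L * S - L) i j ^ 2
  refine ⟨fun a ha b hb hab => ?_, ?_, fun c hc => ?_⟩
  · have ha : 0 < a := ha
    have hb : 0 < b := hb
    refine Real.sqrt_lt_sqrt (by positivity) ?_
    gcongr
  · rintro _ ⟨τ, -, rfl⟩
    exact Real.sqrt_le_sqrt (le_add_of_nonneg_left (by positivity))
  · have hlim : Filter.Tendsto (fun τ : ℝ => √(τ⁻¹ ^ 2 * p + m)) Filter.atTop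
        (nhds √m) := by
      simpa using ((((tendsto_inv_atTop_zero (𝕜 := ℝ)).pow 2).mul_const p).add_const m).sqrt
    refine ge_of_tendsto hlim ?_
    filter_upwards [Filter.Ioi_mem_atTop (0 : ℝ)] with τ hτ
    exact hc ⟨τ, hτ, rfl⟩
end

section
/- Every complex eigenvalue λ of the Laplacian matrix L (viewed as a complex matrix via the inclusion ℝ ⊆ ℂ) satisfies Re λ ≥ 0; moreover, if λ ≠ 0 then Re λ > 0. Equivalently, the real parts of all nonzero eigenvalues of −L are strictly negative. -/
/-- A point of a closed disc centred at `r ≥ 0` with radius `r` is either zero or has positive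
real part. -/
theorem Complex.re_pos_of_mem_closedBall_self {r : ℝ} (hr : 0 ≤ r) {z : ℂ}
    (hz : z ∈ Metric.closedBall (r : ℂ) r) (hz0 : z ≠ 0) : 0 < z.re := by
  have hsq : ‖z - r‖ ^ 2 ≤ r ^ 2 := by
    have := mem_closedBall_iff_norm.mp hz
    gcongr
  have hpos : 0 < Complex.normSq z := Complex.normSq_pos.mpr hz0
  rw [Complex.sq_norm, Complex.normSq_apply] at hsq
  rw [Complex.normSq_apply] at hpos
  simp only [Complex.sub_re, Complex.ofReal_re, Complex.sub_im, Complex.ofReal_im] at hsq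
  by_contra! h
  nlinarith [mul_nonneg hr (neg_nonneg.mpr h)]

/-- Nonzero eigenvalues of the Laplacian of a nonnegative matrix have positive real part. -/
theorem Matrix.re_pos_of_mem_spectrum_laplacian {ι : Type*} [Fintype ι] [DecidableEq ι]
    {A : Matrix ι ι ℝ} (hA : ∀ i j, 0 ≤ A i j) {μ : ℂ}
    (hμ : μ ∈ spectrum ℂ
      ((Matrix.diagonal (fun i => ∑ j, A i j) - A).map Complex.ofReal)) (hμ0 : μ ≠ 0) :
    0 < μ.re := by
  rw [← Matrix.spectrum_toLin', ← Module.End.hasEigenvalue_iff_mem_spectrum] at hμ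
  obtain ⟨k, hk⟩ := eigenvalue_mem_ball hμ
  have hr : 0 ≤ ∑ j ∈ Finset.univ.erase k, A k j := Finset.sum_nonneg fun j _ => hA k j
  refine Complex.re_pos_of_mem_closedBall_self hr ?_ hμ0
  convert hk using 2
  · rw [Matrix.map_apply, Matrix.sub_apply, Matrix.diagonal_apply_eq,
      Finset.sum_erase_eq_sub (Finset.mem_univ k)]
  · refine Finset.sum_congr rfl fun j hj => ?_
    rw [Matrix.map_apply, Matrix.sub_apply,
      Matrix.diagonal_apply_ne _ (Finset.ne_of_mem_erase hj).symm, zero_sub,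
      Complex.norm_real, norm_neg, Real.norm_of_nonneg (hA k j)]

/-- Every complex eigenvalue λ of L satisfies Re λ ≥ 0, and Re λ > 0 when λ ≠ 0;
equivalently, nonzero eigenvalues of −L have strictly negative real parts. -/
theorem stmt19 {n : ℕ} (hn : 0 < n) (A L : Matrix (Fin n) (Fin n) ℝ)
    (hA : ∀ i j, 0 ≤ A i j)
    (hL : L = Matrix.diagonal (fun i => ∑ j, A i j) - A) :
    (∀ μ : ℂ, μ ∈ spectrum ℂ (L.map Complex.ofReal) →
        0 ≤ μ.re ∧ (μ ≠ 0 → 0 < μ.re)) ∧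
      ∀ μ : ℂ, μ ∈ spectrum ℂ ((-L).map Complex.ofReal) → μ ≠ 0 → μ.re < 0 := by
  subst hL
  refine ⟨fun μ hμ => ?_, fun μ hμ hμ0 => ?_⟩
  · have hpos := Matrix.re_pos_of_mem_spectrum_laplacian hA hμ
    refine ⟨?_, hpos⟩
    by_cases hμ0 : μ = 0
    · simp [hμ0]
    · exact (hpos hμ0).le
  · rw [Matrix.map_neg _ Complex.ofReal_neg, ← spectrum.neg_eq, Set.mem_neg] at hμ
    have hpos := Matrix.re_pos_of_mem_spectrum_laplacian hA hμ (neg_ne_zero.mpr hμ0)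
    rwa [Complex.neg_re, neg_pos] at hpos
end
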